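/- arXiv:2502.08462 — 4 statements merged into one kernel-verified Lean document; each statement's English description precedes it below -/
import Mathlib

section
/- Let k ≥ 1 be an integer and G a finite graph. If V₁ and V₂ are vertex subsets of G such that the subgraphs induced by V₁ and by V₂ are each k-deeply connected and V₁ ∩ V₂ ≠ ∅, then the subgraph induced by V₁ ∪ V₂ is k-deeply connected. Consequently every vertex of G belongs to exactly one k-deeply connected component, so G is uniquely partitioned into k-deeply connected components. -/
open MeasureTheory Filter

noncomputable section

/-- `∑_{i ≥ k} x^i / i!`. -/
noncomputable def sumFrom (k : ℕ) (x : ℝ) : ℝ :=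
  ∑' i : ℕ, if k ≤ i then x ^ i / (Nat.factorial i) else 0

/-- `π_k(x) = Pr[Pois(x) ≥ k] = ∑_{i ≥ k} x^i e^{-x} / i!`. -/
noncomputable def ptail (k : ℕ) (x : ℝ) : ℝ :=
  ∑' i : ℕ, if k ≤ i then x ^ i * Real.exp (-x) / (Nat.factorial i) else 0

/-- `c` is the positive root of `c · (∑_{i≥k−1}(2c)^i/i!)/(∑_{i≥k}(2c)^i/i!) = k`,
i.e. the constant `c'_k`. -/
def IsCkPrime (k : ℕ) (c : ℝ) : Prop :=
  0 < c ∧ c * sumFrom (k - 1) (2 * c) = k * sumFrom k (2 * c)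

/-- `lam` is the largest root `λ` of `c = λ / π_{j-1}(λ)`, i.e. of `λ = c · π_{j-1}(λ)`. -/
def IsLambda (j : ℕ) (c lam : ℝ) : Prop :=
  lam = c * ptail (j - 1) lam ∧ ∀ mu : ℝ, mu = c * ptail (j - 1) mu → mu ≤ lam

/-- `b` is the largest root `β` of the equation `β = Pr[Pois(βc) ≥ k]`. -/
def IsBetaVal (k : ℕ) (c b : ℝ) : Prop :=
  b = ptail k (b * c) ∧ ∀ b' : ℝ, b' = ptail k (b' * c) → b' ≤ b

/-- A set of edges is a spanning tree (on the whole vertex type `V`) if the graph it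
spans is connected and acyclic. -/
def IsSpanningTreeSet {V : Type*} (T : Set (Sym2 V)) : Prop :=
  (SimpleGraph.fromEdgeSet T).Connected ∧ (SimpleGraph.fromEdgeSet T).IsAcyclic

/-- A graph is `k`-deeply connected if it contains `k` pairwise edge-disjoint
spanning trees. -/
def DeeplyConnected {V : Type*} (k : ℕ) (G : SimpleGraph V) : Prop :=
  ∃ T : Fin k → Set (Sym2 V),
    (∀ i, T i ⊆ G.edgeSet) ∧ (∀ i, IsSpanningTreeSet (T i)) ∧
    Pairwise fun i j => Disjoint (T i) (T j)

/-- A `k`-deeply connected component: a vertex set inducing a `k`-deeply connected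
subgraph, maximal by inclusion with this property. -/
def DeepComponent {V : Type*} (k : ℕ) (G : SimpleGraph V) (C : Set V) : Prop :=
  DeeplyConnected k (G.induce C) ∧
    ∀ C' : Set V, C ⊆ C' → DeeplyConnected k (G.induce C') → C' = C

/-- The `κ`-core of a graph: the largest vertex set each of whose vertices has at
least `κ` neighbours inside the set. -/
def coreSet {V : Type*} (κ : ℕ) (G : SimpleGraph V) : Set V :=
  ⋃₀ {C : Set V | ∀ v ∈ C, κ ≤ (C ∩ G.neighborSet v).ncard}

/-- `E` can be written as a disjoint union of `k` forests. -/
def PartitionsIntoForests {V : Type*} (k : ℕ) (E : Finset (Sym2 V)) : Prop :=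
  ∃ F : Fin k → Finset (Sym2 V),
    (∀ i, F i ⊆ E) ∧ (∀ e ∈ E, ∃ i, e ∈ F i) ∧
    (Pairwise fun i j => Disjoint (F i) (F j)) ∧
    ∀ i, (SimpleGraph.fromEdgeSet (↑(F i) : Set (Sym2 V))).IsAcyclic

/-- The rank of an edge set in the union matroid `M^k` of `k` copies of the graphic
matroid: the largest cardinality of a subset that splits into `k` forests. -/
noncomputable def rkk {V : Type*} (k : ℕ) (E : Set (Sym2 V)) : ℕ :=
  sSup {m : ℕ | ∃ F : Finset (Sym2 V), ↑F ⊆ E ∧ PartitionsIntoForests k F ∧ F.card = m}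

/-- The edges of `S` with both endpoints in `U`. -/
def edgesIn {V : Type*} (S : Set (Sym2 V)) (U : Set V) : Set (Sym2 V) :=
  {e | e ∈ S ∧ ∀ v ∈ e, v ∈ U}

instance measFinset {n : ℕ} : MeasurableSpace (Finset (Sym2 (Fin n))) := ⊤

/-- The `m`-element sets of non-loop edges of `K_n`. -/
def graphEdgeSets (n m : ℕ) : Finset (Finset (Sym2 (Fin n))) :=
  Finset.univ.filter fun S => S.card = m ∧ ∀ e ∈ S, ¬ e.IsDiag

/-- The uniform random graph `G(n,m)`, as a measure on edge sets. -/
noncomputable def gnm (n m : ℕ) : Measure (Finset (Sym2 (Fin n))) :=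
  ((graphEdgeSets n m).card : ENNReal)⁻¹ • ∑ S ∈ graphEdgeSets n m, Measure.dirac S

/-- The binomial random graph `G(n,p)`, as a measure on edge sets. -/
noncomputable def gnp (n : ℕ) (p : ℝ) : Measure (Finset (Sym2 (Fin n))) :=
  ∑ S ∈ (Finset.univ.filter fun S : Finset (Sym2 (Fin n)) => ∀ e ∈ S, ¬ e.IsDiag),
    ENNReal.ofReal (p ^ S.card * (1 - p) ^ (n.choose 2 - S.card)) • Measure.dirac S

/-- The graph spanned by a finite set of edges. -/
def graphOf {n : ℕ} (S : Finset (Sym2 (Fin n))) : SimpleGraph (Fin n) :=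
  SimpleGraph.fromEdgeSet (↑S : Set (Sym2 (Fin n)))

instance measProc {n : ℕ} : MeasurableSpace (Fin (n.choose 2) → Sym2 (Fin n)) := ⊤

/-- Enumerations of the edges of `K_n` in some order: the sample space of the
random graph process. -/
def procSet (n : ℕ) : Finset (Fin (n.choose 2) → Sym2 (Fin n)) :=
  Finset.univ.filter fun f => Function.Injective f ∧ ∀ i, ¬ (f i).IsDiag

/-- The random graph process: a uniformly random enumeration of the edges of `K_n`. -/
noncomputable def procMeasure (n : ℕ) : Measure (Fin (n.choose 2) → Sym2 (Fin n)) :=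
  ((procSet n).card : ENNReal)⁻¹ • ∑ f ∈ procSet n, Measure.dirac f

/-- The first `m` edges of the process `f`, i.e. the edge set of `G_m`. -/
def edgesUpTo (n : ℕ) (f : Fin (n.choose 2) → Sym2 (Fin n)) (m : ℕ) : Set (Sym2 (Fin n)) :=
  {e | ∃ i : Fin (n.choose 2), (i : ℕ) < m ∧ f i = e}

/-- The non-loop edges of `K_n`, i.e. the index set of i.i.d. edge weights. -/
abbrev EdgeType (n : ℕ) : Type := {e : Sym2 (Fin n) // ¬ e.IsDiag}

/-- The minimum total weight of a union of `k` pairwise edge-disjoint spanning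
trees of the complete graph `K_n` with edge weights `w`. -/
noncomputable def minTreesWeight (k n : ℕ) (w : EdgeType n → ℝ) : ℝ :=
  sInf {W : ℝ | ∃ T : Fin k → Finset (EdgeType n),
    (∀ i, IsSpanningTreeSet (Subtype.val '' (↑(T i) : Set (EdgeType n)))) ∧
    (Pairwise fun i j => Disjoint (T i) (T j)) ∧
    W = ∑ i : Fin k, ∑ e ∈ T i, w e}

/-- The sum over all non-trivial `k`-deeply connected components `C` of `G_m`
of `(|C|/n)²`, in the random graph process `f`. -/
noncomputable def sqSum (k n : ℕ) (f : Fin (n.choose 2) → Sym2 (Fin n)) (m : ℕ) : ℝ :=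
  ∑ᶠ C ∈ {C : Set (Fin n) |
      DeepComponent k (SimpleGraph.fromEdgeSet (edgesUpTo n f m)) C ∧ 2 ≤ C.ncard},
    ((C.ncard : ℝ) / n) ^ 2

/-- The rank increment `𝕀_i = rk_k(G_i) − rk_k(G_{i−1})` in the random graph process. -/
noncomputable def rkInc (k n : ℕ) (i : ℕ) (f : Fin (n.choose 2) → Sym2 (Fin n)) : ℝ :=
  (rkk k (edgesUpTo n f i) : ℝ) - (rkk k (edgesUpTo n f (i - 1)) : ℝ)

/-- `𝒫'_i`: the conditional expectation of `𝕀_i` given the first `i−1` edges. -/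
noncomputable def condP (k n : ℕ) (i : ℕ) : (Fin (n.choose 2) → Sym2 (Fin n)) → ℝ :=
  MeasureTheory.condExp
    (MeasurableSpace.comap (fun f => (List.ofFn f).take (i - 1)) (⊤ : MeasurableSpace (List (Sym2 (Fin n)))))
    (procMeasure n) (rkInc k n i)

/-- The rank function of a matroid: the largest size of an independent subset. -/
noncomputable def matRank {α : Type*} (M : Matroid α) (X : Set α) : ℕ :=
  sSup {m : ℕ | ∃ I ⊆ X, M.Indep I ∧ I.ncard = m}

end

theorem deeply_of_connected {W : Type*} [Finite W] (k : ℕ) (G : SimpleGraph W)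
    (H : Fin k → SimpleGraph W) (hle : ∀ i, H i ≤ G) (hc : ∀ i, (H i).Connected)
    (hd : ∀ i j a b, (H i).Adj a b → (H j).Adj a b → i = j) : DeeplyConnected k G := by
  choose T hT hT' using fun i => (hc i).exists_isTree_le
  refine ⟨fun i => (T i).edgeSet, fun i => ?_, fun i => ?_, fun i j hij => ?_⟩
  · exact SimpleGraph.edgeSet_mono ((hT i).trans (hle i))
  · unfold IsSpanningTreeSet
    rw [SimpleGraph.fromEdgeSet_edgeSet]
    exact ⟨(hT' i).1, (hT' i).2⟩
  · refine Set.disjoint_left.2 ?_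
    intro e
    induction e using Sym2.ind with
    | _ a b =>
      intro h1 h2
      exact hij (hd i j a b (hT i h1) (hT j h2))

theorem deeply_iff {W : Type*} {k : ℕ} {G : SimpleGraph W} (h : DeeplyConnected k G) :
    ∃ H : Fin k → SimpleGraph W, (∀ i, H i ≤ G) ∧ (∀ i, (H i).Connected) ∧
      ∀ i j a b, (H i).Adj a b → (H j).Adj a b → i = j := by
  obtain ⟨T, h1, h2, h3⟩ := h
  refine ⟨fun i => SimpleGraph.fromEdgeSet (T i), fun i a b hab => ?_, fun i => (h2 i).1, ?_⟩
  · exact h1 i ((SimpleGraph.fromEdgeSet_adj _).1 hab).1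
  · intro i j a b hi hj
    by_contra hij
    exact Set.disjoint_left.1 (h3 hij) ((SimpleGraph.fromEdgeSet_adj _).1 hi).1
      ((SimpleGraph.fromEdgeSet_adj _).1 hj).1

def glueGraph {V : Type*} (V₁ V₂ : Set V) (A : SimpleGraph V₁) (B : SimpleGraph V₂) :
    SimpleGraph ↥(V₁ ∪ V₂) where
  Adj a b := (∃ (ha : a.1 ∈ V₁) (hb : b.1 ∈ V₁), A.Adj ⟨a.1, ha⟩ ⟨b.1, hb⟩) ∨
    (¬ (a.1 ∈ V₁ ∧ b.1 ∈ V₁) ∧ ∃ (ha : a.1 ∈ V₂) (hb : b.1 ∈ V₂), B.Adj ⟨a.1, ha⟩ ⟨b.1, hb⟩)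
  symm := ⟨by
    rintro a b (⟨ha, hb, h⟩ | ⟨hn, ha, hb, h⟩)
    · exact Or.inl ⟨hb, ha, h.symm⟩
    · exact Or.inr ⟨fun h => hn h.symm, hb, ha, h.symm⟩⟩
  loopless := ⟨by
    rintro a (⟨ha, hb, h⟩ | ⟨hn, ha, hb, h⟩)
    · exact A.loopless.irrefl _ h
    · exact B.loopless.irrefl _ h⟩

theorem glue_connected {V : Type*} (V₁ V₂ : Set V) (A : SimpleGraph V₁) (B : SimpleGraph V₂)
    (hA : A.Connected) (hB : B.Connected) (x : V) (hx1 : x ∈ V₁) (hx2 : x ∈ V₂) :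
    (glueGraph V₁ V₂ A B).Connected := by
  have key1 : ∀ u : V₁, (glueGraph V₁ V₂ A B).Reachable ⟨u.1, Or.inl u.2⟩ ⟨x, Or.inl hx1⟩ := by
    intro u
    let f : A →g glueGraph V₁ V₂ A B :=
      ⟨fun u => ⟨u.1, Or.inl u.2⟩, fun {a b} h => Or.inl ⟨a.2, b.2, h⟩⟩
    exact (hA.preconnected u ⟨x, hx1⟩).map f
  have key2 : ∀ (u w : V₂), B.Walk u w → w.1 = x →
      (glueGraph V₁ V₂ A B).Reachable ⟨u.1, Or.inr u.2⟩ ⟨x, Or.inl hx1⟩ := by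
    intro u w p
    induction p with
    | nil =>
      rename_i u
      rintro rfl
      exact SimpleGraph.Reachable.refl _
    | cons h p ih =>
      rename_i u v w
      intro hw
      by_cases hu : u.1 ∈ V₁
      · exact key1 ⟨u.1, hu⟩
      · have hadj : (glueGraph V₁ V₂ A B).Adj ⟨u.1, Or.inr u.2⟩ ⟨v.1, Or.inr v.2⟩ :=
          Or.inr ⟨fun h => hu h.1, u.2, v.2, h⟩
        exact hadj.reachable.trans (ih hw)
  have key : ∀ u : ↥(V₁ ∪ V₂), (glueGraph V₁ V₂ A B).Reachable u ⟨x, Or.inl hx1⟩ := by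
    rintro ⟨u, hu | hu⟩
    · exact key1 ⟨u, hu⟩
    · obtain ⟨p⟩ := hB.preconnected ⟨u, hu⟩ ⟨x, hx2⟩
      exact key2 _ _ p rfl
  exact { preconnected := fun a b => (key a).trans (key b).symm
          nonempty := ⟨⟨x, Or.inl hx1⟩⟩ }

theorem deeply_union {V : Type*} [Finite V] (k : ℕ) (G : SimpleGraph V)
    (V₁ V₂ : Set V)
    (h1 : DeeplyConnected k (G.induce V₁)) (h2 : DeeplyConnected k (G.induce V₂))
    (hint : (V₁ ∩ V₂).Nonempty) :
    DeeplyConnected k (G.induce (V₁ ∪ V₂)) := by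
  obtain ⟨A, hA1, hA2, hA3⟩ := deeply_iff h1
  obtain ⟨B, hB1, hB2, hB3⟩ := deeply_iff h2
  obtain ⟨x, hx1, hx2⟩ := hint
  refine deeply_of_connected k _ (fun i => glueGraph V₁ V₂ (A i) (B i)) ?_
    (fun i => glue_connected V₁ V₂ _ _ (hA2 i) (hB2 i) x hx1 hx2) ?_
  · rintro i a b (⟨ha, hb, h⟩ | ⟨hn, ha, hb, h⟩)
    · exact hA1 i h
    · exact hB1 i h
  · rintro i j a b (⟨ha, hb, h⟩ | ⟨hn, ha, hb, h⟩) (⟨ha', hb', h'⟩ | ⟨hn', ha', hb', h'⟩)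
    · exact hA3 _ _ _ _ h h'
    · exact absurd ⟨ha, hb⟩ hn'
    · exact absurd ⟨ha', hb'⟩ hn
    · exact hB3 _ _ _ _ h h'

theorem deeply_singleton {V : Type*} [Finite V] (k : ℕ) (G : SimpleGraph V) (v : V) :
    DeeplyConnected k (G.induce {v}) := by
  refine deeply_of_connected k _ (fun _ => ⊥) (fun _ => bot_le) (fun _ => ?_) ?_
  · exact { preconnected := fun a b => by rw [Subsingleton.elim a b]
            nonempty := ⟨⟨v, rfl⟩⟩ }
  · intro i j a b h
    exact absurd h (by simp)

theorem stmt3 {V : Type*} [Fintype V] (k : ℕ) (hk : 1 ≤ k) (G : SimpleGraph V)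
    (V₁ V₂ : Set V)
    (h1 : DeeplyConnected k (G.induce V₁)) (h2 : DeeplyConnected k (G.induce V₂))
    (hint : (V₁ ∩ V₂).Nonempty) :
    DeeplyConnected k (G.induce (V₁ ∪ V₂)) ∧
      ∀ v : V, ∃! C : Set V, DeepComponent k G C ∧ v ∈ C := by 
  refine ⟨deeply_union k G V₁ V₂ h1 h2 hint, fun v => ?_⟩
  obtain ⟨C, hC⟩ := (Set.toFinite {C : Set V | DeeplyConnected k (G.induce C) ∧ v ∈ C}).exists_maximal
    ⟨{v}, deeply_singleton k G v, rfl⟩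
  refine ⟨C, ⟨⟨hC.1.1, fun C' hCC' hC' => ?_⟩, hC.1.2⟩, ?_⟩
  · exact Set.Subset.antisymm (hC.2 ⟨hC', hCC' hC.1.2⟩ hCC') hCC'
  · rintro D ⟨hD, hvD⟩
    have hU := deeply_union k G D C hD.1 hC.1.1 ⟨v, hvD, hC.1.2⟩
    have e1 := hD.2 _ Set.subset_union_left hU
    have e2 : D ∪ C ⊆ C := hC.2 ⟨hU, Or.inl hvD⟩ Set.subset_union_right
    rw [← e1]
    exact Set.Subset.antisymm e2 Set.subset_union_right
end

section
/- Let k ≥ 1 be an integer and let E be the edge set of a finite graph on vertex set V. Then E can be partitioned into k forests (i.e., E is independent in the k-fold union M^k of the graphic matroid) if and only if for every nonempty subset S ⊆ V, the number of edges of E with both endpoints in S is at most k·(|S| − 1). -/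
open MeasureTheory Filter

namespace NW
open SimpleGraph

theorem reach_trans {V : Type*} {G H : SimpleGraph V}
    (h : ∀ a b, G.Adj a b → H.Reachable a b) {u v : V} (huv : G.Reachable u v) :
    H.Reachable u v := by
  obtain ⟨p⟩ := huv
  induction p with
  | nil => exact Reachable.refl _
  | cons hadj _ ih => exact (h _ _ hadj).trans ih

theorem fromEdgeSet_insert {V : Type*} (X : Set (Sym2 V)) (u v : V) :
    fromEdgeSet (insert s(u, v) X) = fromEdgeSet X ⊔ edge u v := by
  rw [Set.insert_eq, Set.union_comm, fromEdgeSet_union]; rfl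

theorem edgesIn_eq_image {V : Type*} (F : Set (Sym2 V)) (hF : ∀ e ∈ F, ¬ e.IsDiag) (S : Set V) :
    edgesIn F S = Sym2.map Subtype.val '' ((fromEdgeSet F).induce S).edgeSet := by
  ext e
  constructor
  · rintro ⟨he, hS⟩
    induction e with
    | _ x y =>
      have hne := hF _ he
      refine ⟨s(⟨x, hS x (by simp)⟩, ⟨y, hS y (by simp)⟩), ?_, by simp⟩
      simpa using ⟨he, by simpa using hne⟩
  · rintro ⟨e', he', rfl⟩
    induction e' with
    | _ x y =>
      have he' : s(x.1, y.1) ∈ F ∧ x.1 ≠ y.1 := by simpa using he'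
      refine ⟨he'.1, ?_⟩
      intro v hv
      have hv : v = x.1 ∨ v = y.1 := by simpa using hv
      rcases hv with rfl | rfl
      · exact x.2
      · exact y.2

theorem ncard_edgesIn {V : Type*} (F : Set (Sym2 V)) (hF : ∀ e ∈ F, ¬ e.IsDiag) (S : Set V) :
    (edgesIn F S).ncard = Nat.card ((fromEdgeSet F).induce S).edgeSet := by
  rw [edgesIn_eq_image F hF,
    Set.ncard_image_of_injective _ (Sym2.map.injective Subtype.val_injective)]
  rfl

theorem acyclic_card {V : Type*} [Finite V] [Nonempty V] {G : SimpleGraph V} (h : G.IsAcyclic) :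
    Nat.card G.edgeSet + 1 ≤ Nat.card V := by
  classical
  have := Fintype.ofFinite V
  obtain ⟨T, hle, -, hT⟩ := (connected_top (V := V)).exists_isTree_le_of_le_of_isAcyclic le_top h
  rw [Nat.card_eq_fintype_card, Nat.card_eq_fintype_card, ← hT.card_edgeFinset, ← edgeFinset_card]
  have : G.edgeFinset ⊆ T.edgeFinset := by simpa using hle
  have := Finset.card_le_card this
  omega

theorem exch_acyclic {V : Type*} {X : Set (Sym2 V)} {u v : V}
    (hX : (fromEdgeSet X).IsAcyclic) (p : (fromEdgeSet X).Walk u v) (hp : p.IsPath)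
    {f : Sym2 V} (hf : f ∈ p.edges) :
    (fromEdgeSet (insert s(u, v) (X \ {f}))).IsAcyclic := by
  classical
  have hle : fromEdgeSet (X \ {f}) ≤ fromEdgeSet X := fromEdgeSet_mono Set.diff_subset
  rw [fromEdgeSet_insert, isAcyclic_add_edge_iff_of_not_reachable]
  · exact hX.anti hle
  · intro hr
    obtain ⟨q, hq⟩ := hr.exists_isPath
    have hq' : (q.mapLe hle).IsPath := hq.mapLe hle
    have := hX.path_unique ⟨p, hp⟩ ⟨_, hq'⟩
    have h2 : p = q.mapLe hle := congrArg Subtype.val this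
    rw [h2] at hf
    have hf : f ∈ q.edges := by simpa using hf
    have := q.edges_subset_edgeSet hf
    simp only [edgeSet_fromEdgeSet] at this
    exact this.1.2 rfl

/-- The edges of colour `i` in `E` other than the missing edge `e`. -/
def cls {V : Type*} {k : ℕ} (E : Finset (Sym2 V)) (s : (Sym2 V → Fin k) × Sym2 V) (i : Fin k) :
    Set (Sym2 V) := {f | f ∈ E ∧ f ≠ s.2 ∧ s.1 f = i}

def Valid {V : Type*} {k : ℕ} (E : Finset (Sym2 V)) (s : (Sym2 V → Fin k) × Sym2 V) : Prop :=
  s.2 ∈ E ∧ ∀ i, (fromEdgeSet (cls E s i)).IsAcyclic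

open Classical in
def Step {V : Type*} {k : ℕ} (E : Finset (Sym2 V)) (s t : (Sym2 V → Fin k) × Sym2 V) : Prop :=
  Valid E t ∧ t.2 ≠ s.2 ∧ t.1 = Function.update s.1 s.2 (s.1 t.2)

def Good {V : Type*} (k : ℕ) (E : Finset (Sym2 V)) : Prop :=
  ∃ c : Sym2 V → Fin k, ∀ i, (fromEdgeSet {f | f ∈ E ∧ c f = i}).IsAcyclic

theorem cls_step_self {V : Type*} {k : ℕ} {E : Finset (Sym2 V)} {c : Sym2 V → Fin k}
    {e f : Sym2 V} (he : e ∈ E) (hne : f ≠ e) [DecidableEq (Sym2 V)] :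
    cls E (Function.update c e (c f), f) (c f) = insert e (cls E (c, e) (c f) \ {f}) := by
  ext g
  simp only [cls, Set.mem_setOf_eq, Set.mem_insert_iff, Set.mem_diff, Set.mem_singleton_iff]
  by_cases hg : g = e
  · subst hg; simp [he, hne.symm]
  · simp [Function.update_of_ne hg, hg]; tauto

theorem cls_step_ne {V : Type*} {k : ℕ} {E : Finset (Sym2 V)} {c : Sym2 V → Fin k}
    {e f : Sym2 V} {i : Fin k} (hi : c f ≠ i) [DecidableEq (Sym2 V)] :
    cls E (Function.update c e (c f), f) i = cls E (c, e) i := by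
  ext g
  simp only [cls, Set.mem_setOf_eq]
  by_cases hg : g = e
  · subst hg; simp [hi]
  · simp only [Function.update_of_ne hg, hg, not_false_eq_true, true_and, ne_eq]
    constructor
    · tauto
    · rintro ⟨h1, h2⟩; refine ⟨h1, ?_, h2⟩; rintro rfl; exact hi h2

theorem claim1 {V : Type*} {k : ℕ} {E : Finset (Sym2 V)} (hE : ∀ e ∈ E, ¬ e.IsDiag)
    (hbad : ¬ Good k E)
    {s : (Sym2 V → Fin k) × Sym2 V} (hs : Valid E s) (A : Set (Sym2 V))
    (hA : ∀ t, Step E s t → t.2 ∈ A) (i : Fin k) {u v : V} (huv : s.2 = s(u, v)) :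
    (fromEdgeSet (cls E s i ∩ A)).Reachable u v := by
  classical
  obtain ⟨c, e⟩ := s
  simp only at huv
  subst huv
  have hr : (fromEdgeSet (cls E (c, s(u, v)) i)).Reachable u v := by
    by_contra hr
    apply hbad
    refine ⟨Function.update c s(u, v) i, fun j => ?_⟩
    by_cases hj : j = i
    · subst hj
      have : {f | f ∈ E ∧ Function.update c s(u, v) j f = j}
          = insert s(u, v) (cls E (c, s(u, v)) j) := by
        ext g
        simp only [cls, Set.mem_setOf_eq, Set.mem_insert_iff]
        by_cases hg : g = s(u, v)
        · subst hg; simpa using hs.1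
        · simp [Function.update_of_ne hg, hg]
      rw [this, fromEdgeSet_insert, isAcyclic_add_edge_iff_of_not_reachable _ _ hr]
      exact hs.2 j
    · refine (hs.2 j).anti (fromEdgeSet_mono ?_)
      rintro g ⟨hg, hgj⟩
      by_cases h : g = s(u, v)
      · subst h; simp at hgj; exact absurd hgj.symm hj
      · rw [Function.update_of_ne h] at hgj
        exact ⟨hg, h, hgj⟩
  obtain ⟨p, hp⟩ := hr.exists_isPath
  refine ⟨p.transfer _ ?_⟩
  intro f hf
  have hf1 := p.edges_subset_edgeSet hf
  rw [edgeSet_fromEdgeSet] at hf1 ⊢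
  refine ⟨⟨hf1.1, ?_⟩, hf1.2⟩
  obtain ⟨⟨hfE, hfne, hfi⟩, -⟩ := hf1
  simp only at hfne hfi
  refine hA (Function.update c s(u, v) (c f), f) ⟨⟨hfE, fun j => ?_⟩, hfne, rfl⟩
  by_cases hj : c f = j
  · subst hj
    subst hfi
    rw [cls_step_self hs.1 hfne]
    exact exch_acyclic (hs.2 _) p hp hf
  · rw [cls_step_ne hj]; exact hs.2 j

theorem claim2 {V : Type*} {k : ℕ} {E : Finset (Sym2 V)} (hE : ∀ e ∈ E, ¬ e.IsDiag)
    (hbad : ¬ Good k E)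
    {s t : (Sym2 V → Fin k) × Sym2 V} (hs : Valid E s) (A : Set (Sym2 V))
    (hA : ∀ t, Step E s t → t.2 ∈ A) (hst : Step E s t) (i : Fin k) {u v : V}
    (h : (fromEdgeSet (cls E t i ∩ A)).Reachable u v) :
    (fromEdgeSet (cls E s i ∩ A)).Reachable u v := by
  classical
  refine reach_trans ?_ h
  intro a b hab
  rw [fromEdgeSet_adj] at hab
  obtain ⟨⟨hab1, habA⟩, hne⟩ := hab
  obtain ⟨htV, htne, ht1⟩ := hst
  obtain ⟨c, e⟩ := s
  obtain ⟨c', f⟩ := t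
  simp only at ht1 htne
  have ht1 : c' = Function.update c e (c f) := by rw [ht1]
  subst ht1
  by_cases hi : c f = i
  · subst hi
    rw [cls_step_self hs.1 htne] at hab1
    rcases hab1 with hab1 | hab1
    · exact claim1 hE hbad hs A hA _ hab1.symm
    · exact Adj.reachable (by rw [fromEdgeSet_adj]; exact ⟨⟨hab1.1, habA⟩, hne⟩)
  · rw [cls_step_ne hi] at hab1
    exact Adj.reachable (by rw [fromEdgeSet_adj]; exact ⟨⟨hab1, habA⟩, hne⟩)

theorem edgesIn_mono {V : Type*} {X Y : Set (Sym2 V)} (h : X ⊆ Y) (S : Set V) :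
    edgesIn X S ⊆ edgesIn Y S := fun _ he => ⟨h he.1, he.2⟩

theorem key {V : Type*} [Fintype V] {k : ℕ} {E : Finset (Sym2 V)} (hE : ∀ e ∈ E, ¬ e.IsDiag)
    (hS : ∀ S : Set V, S.Nonempty → (edgesIn (↑E) S).ncard ≤ k * (S.ncard - 1))
    (s : (Sym2 V → Fin k) × Sym2 V) (hs : Valid E s) : Good k E := by
  classical
  by_contra hbad
  let A : Set (Sym2 V) := {f | ∃ t, Relation.ReflTransGen (Step E) s t ∧ t.2 = f}
  have hval : ∀ t, Relation.ReflTransGen (Step E) s t → Valid E t := by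
    intro t ht
    induction ht with
    | refl => exact hs
    | tail _ h _ => exact h.1
  have hA : ∀ t, Relation.ReflTransGen (Step E) s t → ∀ t', Step E t t' → t'.2 ∈ A :=
    fun t ht t' ht' => ⟨t', ht.tail ht', rfl⟩
  have hdown : ∀ t, Relation.ReflTransGen (Step E) s t → ∀ i u v,
      (fromEdgeSet (cls E t i ∩ A)).Reachable u v →
      (fromEdgeSet (cls E s i ∩ A)).Reachable u v := by
    intro t ht i u v
    induction ht with
    | refl => exact id
    | tail h1 h2 ih => exact fun h => ih (claim2 hE hbad (hval _ h1) A (hA _ h1) h2 i h)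
  have hAr : ∀ i u v, s(u, v) ∈ A → (fromEdgeSet (cls E s i ∩ A)).Reachable u v := by
    rintro i u v ⟨t, ht, htu⟩
    exact hdown t ht i u v (claim1 hE hbad (hval t ht) A (hA t ht) i htu)
  obtain ⟨u0, v0, h0⟩ : ∃ u v, s.2 = s(u, v) := by
    induction h : s.2 with
    | _ x y => exact ⟨x, y, rfl⟩
  have h0A : s(u0, v0) ∈ A := ⟨s, .refl, h0⟩
  let U : Set V := ((fromEdgeSet A).connectedComponentMk u0).supp
  have hU : ∀ i, ((fromEdgeSet (cls E s i ∩ A)).connectedComponentMk u0).supp = U := by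
    intro i
    ext x
    simp only [U, ConnectedComponent.mem_supp_iff, ConnectedComponent.eq]
    constructor
    · exact fun h => h.mono (fromEdgeSet_mono Set.inter_subset_right)
    · exact reach_trans fun a b hab => hAr i a b (by rw [fromEdgeSet_adj] at hab; exact hab.1)
  have hne : U.Nonempty := ⟨u0, by simp [U]⟩
  have hv0 : v0 ∈ U := by
    simp only [U, ConnectedComponent.mem_supp_iff, ConnectedComponent.eq]
    refine Adj.reachable ?_
    rw [fromEdgeSet_adj, Sym2.eq_swap]
    refine ⟨h0A, fun h => hE _ hs.1 ?_⟩
    rw [h0, h]; simp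
  have hcount : ∀ i, U.ncard ≤ (edgesIn (cls E s i) U).ncard + 1 := by
    intro i
    have h1 : U.ncard ≤ (edgesIn (cls E s i ∩ A) U).ncard + 1 := by
      rw [ncard_edgesIn _ (fun e he => hE e he.1.1)]
      have := ((fromEdgeSet (cls E s i ∩ A)).connectedComponentMk
        u0).connected_toSimpleGraph.card_vert_le_card_edgeSet_add_one
      rw [← hU i]
      exact this
    have := Set.ncard_le_ncard (edgesIn_mono (Set.inter_subset_left (s := cls E s i) (t := A)) U)
      (Set.toFinite _)
    omega
  have hsub : insert s.2 (⋃ i, edgesIn (cls E s i) U) ⊆ edgesIn (↑E) U := by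
    intro e he
    rcases he with rfl | he
    · refine ⟨hs.1, ?_⟩
      rw [h0]
      intro v hv
      have hv : v = u0 ∨ v = v0 := by simpa using hv
      rcases hv with rfl | rfl
      · simp [U]
      · exact hv0
    · obtain ⟨i, hi⟩ := Set.mem_iUnion.1 he
      exact ⟨hi.1.1, hi.2⟩
  have hle := Set.ncard_le_ncard hsub (Set.toFinite _)
  rw [Set.ncard_insert_of_notMem ?_ (Set.toFinite _)] at hle
  swap
  · intro h
    obtain ⟨i, hi⟩ := Set.mem_iUnion.1 h
    exact hi.1.2.1 rfl
  have hun : (⋃ i, edgesIn (cls E s i) U).ncard = ∑ i, (edgesIn (cls E s i) U).ncard := by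
    rw [Set.ncard_iUnion_of_finite (fun i => Set.toFinite _), finsum_eq_sum_of_fintype]
    intro i j hij
    refine Set.disjoint_left.2 fun e h1 h2 => hij ?_
    exact h1.1.2.2.symm.trans h2.1.2.2
  have hsum : ∑ _i : Fin k, (U.ncard - 1) ≤ ∑ i, (edgesIn (cls E s i) U).ncard :=
    Finset.sum_le_sum fun i _ => by have := hcount i; omega
  simp only [Finset.sum_const, Finset.card_univ, Fintype.card_fin, smul_eq_mul] at hsum
  have := hS U hne
  omega

theorem main {V : Type*} [Fintype V] {k : ℕ} (hk : 1 ≤ k) (E : Finset (Sym2 V))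
    (hE : ∀ e ∈ E, ¬ e.IsDiag)
    (hS : ∀ S : Set V, S.Nonempty → (edgesIn (↑E) S).ncard ≤ k * (S.ncard - 1)) :
    Good k E := by
  classical
  induction E using Finset.induction_on with
  | empty => exact ⟨fun _ => ⟨0, hk⟩, fun i => by simp⟩
  | insert e E' he ih =>
    obtain ⟨c, hc⟩ := ih (fun e h => hE e (by simp [h])) (fun S hSn => le_trans
      (Set.ncard_le_ncard (edgesIn_mono (by simp) S) (Set.toFinite _)) (hS S hSn))
    refine key hE hS (c, e) ⟨by simp, fun i => (hc i).anti (fromEdgeSet_mono ?_)⟩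
    rintro f ⟨h1, h2, h3⟩
    exact ⟨(Finset.mem_insert.1 h1).resolve_left h2, h3⟩

end NW

theorem stmt5 {V : Type*} [Fintype V] (k : ℕ) (hk : 1 ≤ k)
    (E : Finset (Sym2 V)) (hE : ∀ e ∈ E, ¬ e.IsDiag) :
    PartitionsIntoForests k E ↔
      ∀ S : Set V, S.Nonempty →
        (edgesIn (↑E) S).ncard ≤ k * (S.ncard - 1) := by
  classical
  constructor
  · rintro ⟨F, hsub, hcov, -, hac⟩ S hS
    have h1 : edgesIn (↑E) S ⊆ ⋃ i, edgesIn (↑(F i)) S := by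
      rintro e ⟨he, h⟩
      obtain ⟨i, hi⟩ := hcov e he
      exact Set.mem_iUnion.2 ⟨i, hi, h⟩
    have h2 : ∀ i, (edgesIn (↑(F i) : Set (Sym2 V)) S).ncard ≤ S.ncard - 1 := by
      intro i
      rw [NW.ncard_edgesIn _ (fun e he => hE e (hsub i he))]
      have : Nonempty S := hS.to_subtype
      have := NW.acyclic_card ((hac i).induce S)
      have h3 : Nat.card S = S.ncard := rfl
      omega
    calc _ ≤ (⋃ i, edgesIn (↑(F i) : Set (Sym2 V)) S).ncard :=
          Set.ncard_le_ncard h1 (Set.toFinite _)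
      _ ≤ ∑ i, (edgesIn (↑(F i) : Set (Sym2 V)) S).ncard := by
          exact Set.ncard_iUnion_le_of_fintype _
      _ ≤ ∑ _i : Fin k, (S.ncard - 1) := Finset.sum_le_sum fun i _ => h2 i
      _ = _ := by simp
  · intro hS
    obtain ⟨c, hc⟩ := NW.main hk E hE hS
    refine ⟨fun i => E.filter fun f => c f = i, fun i => Finset.filter_subset _ _,
      fun e he => ⟨c e, by simp [he]⟩, ?_, fun i => ?_⟩
    · intro i j hij
      refine Finset.disjoint_left.2 fun e h1 h2 => hij ?_
      exact (Finset.mem_filter.1 h1).2.symm.trans (Finset.mem_filter.1 h2).2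
    · simpa using hc i
end

section
/- Let k ≥ 1 be an integer, let G = (V, E) be a finite graph, and let e be a pair of vertices of V with e ∉ E. Then rk_k(E ∪ {e}) = rk_k(E) if and only if both endpoints of e lie in the same k-deeply connected component of G. -/
open MeasureTheory Filter

open Classical in
theorem aux_reach_of_adj {V : Type*} {G H : SimpleGraph V}
    (h : ∀ x y, G.Adj x y → H.Reachable x y) {x y : V} (hxy : G.Reachable x y) :
    H.Reachable x y := by
  obtain ⟨p⟩ := hxy
  induction p with
  | nil => exact SimpleGraph.Reachable.refl _
  | cons hadj _ ih => exact (h _ _ hadj).trans ih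

/-- A forest all of whose edges are spanned by `M` has at most as many edges as `M`. -/
theorem aux_card_le {V : Type*} [Fintype V] (A M : Set (Sym2 V))
    (hA : ∀ e ∈ A, ¬ e.IsDiag)
    (hac : (SimpleGraph.fromEdgeSet A).IsAcyclic)
    (h : ∀ x y, s(x, y) ∈ A → (SimpleGraph.fromEdgeSet M).Reachable x y) :
    A.ncard ≤ M.ncard := by
  classical
  rcases isEmpty_or_nonempty V with hV | hV
  · have : A = ∅ := Set.eq_empty_of_isEmpty A
    simp [this]
  obtain ⟨S, hAS, -, hS⟩ := SimpleGraph.Connected.exists_isTree_le_of_le_of_isAcyclic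
    (SimpleGraph.connected_top (V := V)) le_top hac
  have hAS' : A ⊆ S.edgeSet := by
    intro e he
    have := SimpleGraph.edgeSet_mono hAS
    apply this
    rw [SimpleGraph.edgeSet_fromEdgeSet]
    exact ⟨he, hA e he⟩
  have hconn : (SimpleGraph.fromEdgeSet (M ∪ (S.edgeSet \ A))).Connected := by
    refine ⟨fun x y => ?_⟩
    refine aux_reach_of_adj (G := S) ?_ (hS.connected.preconnected x y)
    intro x y hxy
    by_cases hm : s(x, y) ∈ A
    · exact (h x y hm).mono (SimpleGraph.fromEdgeSet_mono Set.subset_union_left)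
    · apply SimpleGraph.Adj.reachable
      rw [SimpleGraph.fromEdgeSet_adj]
      exact ⟨Or.inr ⟨hxy, hm⟩, hxy.ne⟩
  have h1 := hconn.card_vert_le_card_edgeSet_add_one
  have h2 := (SimpleGraph.isTree_iff_connected_and_card.1 hS).2
  rw [Nat.card_coe_set_eq] at h1 h2
  have h3 : (SimpleGraph.fromEdgeSet (M ∪ (S.edgeSet \ A))).edgeSet.ncard
      ≤ (M ∪ (S.edgeSet \ A)).ncard := by
    apply Set.ncard_le_ncard _ (Set.toFinite _)
    rw [SimpleGraph.edgeSet_fromEdgeSet]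
    exact Set.diff_subset
  have h4 := Set.ncard_union_le M (S.edgeSet \ A)
  have h5 := Set.ncard_diff_add_ncard_of_subset hAS' (Set.toFinite _)
  omega

/-- A family of `k` disjoint forests inside `S`. -/
def AuxPack {V : Type*} (k : ℕ) (S : Set (Sym2 V)) (F : Fin k → Finset (Sym2 V)) : Prop :=
  (∀ i, (↑(F i) : Set (Sym2 V)) ⊆ S) ∧ (Pairwise fun i j => Disjoint (F i) (F j)) ∧
    ∀ i, (SimpleGraph.fromEdgeSet (↑(F i) : Set (Sym2 V))).IsAcyclic

theorem aux_bdd {V : Type*} [Fintype V] (k : ℕ) (S : Set (Sym2 V)) :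
    BddAbove {m : ℕ | ∃ F : Finset (Sym2 V), ↑F ⊆ S ∧ PartitionsIntoForests k F ∧ F.card = m} := by
  classical
  refine ⟨Fintype.card (Sym2 V), ?_⟩
  rintro m ⟨F, -, -, rfl⟩
  exact Finset.card_le_univ F

theorem aux_pack_le {V : Type*} [Fintype V] {k : ℕ} {S : Set (Sym2 V)}
    {F : Fin k → Finset (Sym2 V)} (hF : AuxPack k S F) : ∑ i, (F i).card ≤ rkk k S := by
  classical
  apply le_csSup (aux_bdd k S)
  refine ⟨Finset.univ.biUnion F, ?_, ⟨F, ?_, ?_, hF.2.1, hF.2.2⟩, ?_⟩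
  · intro e he
    simp only [Finset.coe_biUnion, Set.mem_iUnion] at he
    obtain ⟨i, -, hi⟩ := he
    exact hF.1 i hi
  · intro i
    exact Finset.subset_biUnion_of_mem F (Finset.mem_univ i)
  · intro e he
    simpa using he
  · rw [Finset.card_biUnion]
    intro i _ j _ hij
    exact hF.2.1 hij

theorem aux_pack_exists {V : Type*} [Fintype V] (k : ℕ) (S : Set (Sym2 V)) :
    ∃ F : Fin k → Finset (Sym2 V), AuxPack k S F ∧ ∑ i, (F i).card = rkk k S := by
  classical
  have hne : {m : ℕ | ∃ F : Finset (Sym2 V), ↑F ⊆ S ∧ PartitionsIntoForests k F ∧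
      F.card = m}.Nonempty := by
    refine ⟨0, ∅, by simp, ⟨fun _ => ∅, by simp, by simp, ?_, ?_⟩, rfl⟩
    · intro i j _
      simp
    · intro i
      simp
  obtain ⟨F, hFS, ⟨P, h1, h2, h3, h4⟩, h5⟩ := Nat.sSup_mem hne (aux_bdd k S)
  refine ⟨P, ⟨fun i => ?_, h3, h4⟩, ?_⟩
  · exact (Finset.coe_subset.2 (h1 i)).trans hFS
  · unfold rkk
    rw [← h5, ← Finset.card_biUnion]
    · congr 1
      ext e
      simp only [Finset.mem_biUnion, Finset.mem_univ, true_and]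
      exact ⟨fun ⟨i, hi⟩ => h1 i hi, h2 e⟩
    · intro i _ j _ hij
      exact h3 hij

theorem aux_rkk_mono {V : Type*} [Fintype V] (k : ℕ) {S T : Set (Sym2 V)} (h : S ⊆ T) :
    rkk k S ≤ rkk k T := by
  obtain ⟨F, hF, hs⟩ := aux_pack_exists k S
  rw [← hs]
  exact aux_pack_le ⟨fun i => (hF.1 i).trans h, hF.2⟩

/-- One direction: spanned pairs do not raise the rank. -/
theorem aux_easy {V : Type*} [Fintype V] (k : ℕ)
    (E : Finset (Sym2 V)) (hE : ∀ e ∈ E, ¬ e.IsDiag)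
    (e : Sym2 V) (he : ¬ e.IsDiag) (heE : e ∉ E) (C : Set V)
    (hC : DeeplyConnected k ((SimpleGraph.fromEdgeSet (↑E : Set (Sym2 V))).induce C))
    (heC : ∀ v ∈ e, v ∈ C) :
    rkk k (insert e (↑E : Set (Sym2 V))) ≤ rkk k (↑E : Set (Sym2 V)) := by
  classical
  obtain ⟨T', hT1, hT2, hT3⟩ := hC
  obtain ⟨F, hF, hFs⟩ := aux_pack_exists k (insert e (↑E : Set (Sym2 V)))
  rw [← hFs]
  let T : Fin k → Set (Sym2 V) := fun i => Sym2.map Subtype.val '' (T' i)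
  have hTE : ∀ i, T i ⊆ ↑E := by
    rintro i _ ⟨f, hf, rfl⟩
    have := hT1 i hf
    induction f with
    | h x y =>
      simp only [SimpleGraph.mem_edgeSet, SimpleGraph.comap_adj, SimpleGraph.fromEdgeSet_adj] at this
      exact this.1
  have hTC : ∀ i, ∀ f ∈ T i, ∀ v ∈ f, v ∈ C := by
    rintro i _ ⟨f, hf, rfl⟩ v hv
    rw [Sym2.mem_map] at hv
    obtain ⟨w, -, rfl⟩ := hv
    exact w.2
  have hTd : ∀ i j, i ≠ j → Disjoint (T i) (T j) := by
    intro i j hij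
    exact (Set.disjoint_image_iff (Sym2.map.injective Subtype.val_injective)).2 (hT3 hij)
  have hTr : ∀ i, ∀ x ∈ C, ∀ y ∈ C, (SimpleGraph.fromEdgeSet (T i)).Reachable x y := by
    intro i x hx y hy
    have := (hT2 i).1.preconnected ⟨x, hx⟩ ⟨y, hy⟩
    let φ : SimpleGraph.fromEdgeSet (T' i) →g SimpleGraph.fromEdgeSet (T i) :=
      ⟨Subtype.val, by
        intro a b hab
        rw [SimpleGraph.fromEdgeSet_adj] at hab ⊢
        exact ⟨⟨_, hab.1, rfl⟩, fun h => hab.2 (Subtype.ext h)⟩⟩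
    exact this.map φ
  have key : ∀ i, ∃ M : Finset (Sym2 V), (F i).card ≤ M.card ∧
      (∀ f ∈ M, f ∈ T i ∨ (f ∈ F i ∧ ¬ ∀ v ∈ f, v ∈ C)) ∧
      (SimpleGraph.fromEdgeSet (↑M : Set (Sym2 V))).IsAcyclic := by
    intro i
    obtain ⟨M0, hM0, hac0, hr0⟩ :=
      (SimpleGraph.fromEdgeSet (T i)).exists_isAcyclic_reachable_eq_le
    obtain ⟨M, hM0M, hM, hac, hr⟩ :=
      (M0 ⊔ SimpleGraph.fromEdgeSet (↑(F i) : Set (Sym2 V))).exists_isAcyclic_reachable_eq_le_of_le_of_isAcyclic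
        le_sup_left hac0
    refine ⟨M.edgeSet.toFinset, ?_, ?_, ?_⟩
    · rw [← Set.ncard_coe_finset, ← Set.ncard_coe_finset, Set.coe_toFinset]
      apply aux_card_le
      · intro f hf
        rcases hF.1 i hf with rfl | hf
        · exact he
        · exact hE _ hf
      · exact hF.2.2 i
      · intro x y hxy
        rw [SimpleGraph.fromEdgeSet_edgeSet, hr]
        by_cases hxy' : x = y
        · subst hxy'
          exact SimpleGraph.Reachable.refl _
        · apply SimpleGraph.Adj.reachable
          right
          rw [SimpleGraph.fromEdgeSet_adj]
          exact ⟨hxy, hxy'⟩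
    · intro f hf
      rw [Set.mem_toFinset] at hf
      induction f with
      | h x y =>
        by_cases h0 : M0.Adj x y
        · left
          have := hM0 h0
          rw [SimpleGraph.fromEdgeSet_adj] at this
          exact this.1
        · right
          have h1 := hM hf
          rw [SimpleGraph.sup_adj, SimpleGraph.fromEdgeSet_adj] at h1
          refine ⟨(h1.resolve_left h0).1, fun hc => ?_⟩
          have hbr := SimpleGraph.isAcyclic_iff_forall_adj_isBridge.1 hac hf
          rw [SimpleGraph.isBridge_iff] at hbr
          apply hbr
          have h2 : M0.Reachable x y := by
            rw [hr0]
            exact hTr i x (hc x (by simp)) y (hc y (by simp))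
          refine h2.mono ?_
          intro a b hab
          rw [SimpleGraph.deleteEdges_adj]
          refine ⟨hM0M hab, ?_⟩
          rw [Set.mem_singleton_iff]
          intro heq
          apply h0
          rw [← SimpleGraph.mem_edgeSet, ← heq]
          exact hab
    · rw [Set.coe_toFinset, SimpleGraph.fromEdgeSet_edgeSet]
      exact hac
  choose M hM1 hM2 hM3 using key
  refine (Finset.sum_le_sum fun i _ => hM1 i).trans (aux_pack_le ⟨?_, ?_, hM3⟩)
  · intro i f hf
    rcases hM2 i f hf with h | ⟨h, hc⟩
    · exact hTE i h
    · rcases hF.1 i h with rfl | h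
      · exact absurd heC hc
      · exact h
  · intro i j hij
    rw [Finset.disjoint_left]
    intro f hf hf'
    rcases hM2 i f hf with h | ⟨h, hc⟩ <;> rcases hM2 j f hf' with h' | ⟨h', hc'⟩
    · exact Set.disjoint_left.1 (hTd i j hij) h h'
    · exact hc' (hTC i f h)
    · exact hc (hTC j f h')
    · exact Finset.disjoint_left.1 (hF.2.1 hij) h h'

open Classical in
/-- Edge replacement. -/
def AuxRep {V : Type*} {k : ℕ} (W : Set (Sym2 V)) (F F' : Fin k → Finset (Sym2 V)) : Prop :=
  ∃ i f g, f ∈ W ∧ (∀ j, f ∉ F j) ∧ g ∈ F i ∧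
    F' = Function.update F i (insert f ((F i).erase g)) ∧
    (SimpleGraph.fromEdgeSet (↑(insert f ((F i).erase g)) : Set (Sym2 V))).IsAcyclic

open Classical in
theorem aux_update_pack {V : Type*} {k : ℕ} {W : Set (Sym2 V)} {F : Fin k → Finset (Sym2 V)}
    (hF : AuxPack k W F) (i : Fin k) (A B : Finset (Sym2 V)) (f : Sym2 V) (hf : f ∈ W)
    (hfF : ∀ j, f ∉ F j) (hB : B ⊆ F i) (hA : A = insert f B)
    (hac : (SimpleGraph.fromEdgeSet (↑A : Set (Sym2 V))).IsAcyclic) :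
    AuxPack k W (Function.update F i A) := by
  subst hA
  have hd : ∀ j, j ≠ i → Disjoint (insert f B) (F j) := by
    intro j hj
    rw [Finset.disjoint_left]
    intro a ha ha'
    rcases Finset.mem_insert.1 ha with rfl | ha
    · exact hfF j ha'
    · exact Finset.disjoint_left.1 (hF.2.1 hj) ha' (hB ha)
  refine ⟨?_, ?_, ?_⟩
  · intro j
    by_cases hj : j = i
    · subst hj
      rw [Function.update_self]
      intro a ha
      rcases Finset.mem_insert.1 ha with rfl | ha
      · exact hf
      · exact hF.1 j (hB ha)
    · rw [Function.update_of_ne hj]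
      exact hF.1 j
  · intro a b hab
    show Disjoint _ _
    by_cases ha : a = i
    · subst ha
      rw [Function.update_self, Function.update_of_ne hab.symm]
      exact hd b hab.symm
    · by_cases hb : b = i
      · subst hb
        rw [Function.update_self, Function.update_of_ne hab]
        exact (hd a hab).symm
      · rw [Function.update_of_ne ha, Function.update_of_ne hb]
        exact hF.2.1 hab
  · intro j
    by_cases hj : j = i
    · subst hj
      rw [Function.update_self]
      exact hac
    · rw [Function.update_of_ne hj]
      exact hF.2.2 j

theorem aux_sum_update {V : Type*} {k : ℕ} (F : Fin k → Finset (Sym2 V)) (i : Fin k)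
    (A : Finset (Sym2 V)) :
    ∑ j, (Function.update F i A j).card + (F i).card = ∑ j, (F j).card + A.card := by
  classical
  rw [← Finset.add_sum_erase _ _ (Finset.mem_univ i),
    ← Finset.add_sum_erase _ (fun j => (F j).card) (Finset.mem_univ i),
    Function.update_self]
  have : ∑ j ∈ Finset.univ.erase i, (Function.update F i A j).card
      = ∑ j ∈ Finset.univ.erase i, (F j).card := by
    apply Finset.sum_congr rfl
    intro j hj
    rw [Function.update_of_ne (Finset.ne_of_mem_erase hj)]
  rw [this]
  ring

theorem aux_rep_max {V : Type*} {k : ℕ} {W : Set (Sym2 V)}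
    {F F' : Fin k → Finset (Sym2 V)} (hF : AuxPack k W F) (h : AuxRep W F F') :
    AuxPack k W F' ∧ ∑ i, (F' i).card = ∑ i, (F i).card := by
  classical
  obtain ⟨i, f, g, hf, hfF, hg, rfl, hac⟩ := h
  refine ⟨aux_update_pack hF i _ _ f hf hfF (Finset.erase_subset g _) (by congr!) hac, ?_⟩
  have := aux_sum_update F i (insert f ((F i).erase g))
  have h2 : (insert f ((F i).erase g)).card = (F i).card := by
    rw [Finset.card_insert_of_notMem (fun h => hfF i (Finset.mem_of_mem_erase h)),
      Finset.card_erase_add_one hg]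
  rw [h2] at this
  convert Nat.add_right_cancel this using 5

/-- Adding an edge between different components of a forest keeps it a forest. -/
theorem aux_insert_acyclic {V : Type*} {A : Set (Sym2 V)} {x y : V}
    (hA : (SimpleGraph.fromEdgeSet A).IsAcyclic)
    (h : ¬ (SimpleGraph.fromEdgeSet A).Reachable x y) :
    (SimpleGraph.fromEdgeSet (insert s(x, y) A)).IsAcyclic := by
  refine (hA.sup_edge_of_not_reachable h).anti ?_
  intro a b hab
  rw [SimpleGraph.fromEdgeSet_adj] at hab
  rw [SimpleGraph.sup_adj, SimpleGraph.edge, SimpleGraph.fromEdgeSet_adj,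
    SimpleGraph.fromEdgeSet_adj]
  rcases hab with ⟨h1 | h1, h2⟩
  · exact Or.inr ⟨h1, h2⟩
  · exact Or.inl ⟨h1, h2⟩

/-- The edges missed by some family obtained by replacements. -/
def auxE0 {V : Type*} {k : ℕ} (W : Set (Sym2 V)) (F0 : Fin k → Finset (Sym2 V)) : Set (Sym2 V) :=
  {f | f ∈ W ∧ ∃ F, Relation.ReflTransGen (AuxRep W) F0 F ∧ ∀ j, f ∉ F j}

theorem aux_step1 {V : Type*} [Fintype V] {k : ℕ} {W : Set (Sym2 V)}
    {F0 F : Fin k → Finset (Sym2 V)}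
    (hF : AuxPack k W F) (hmax : ∑ i, (F i).card = rkk k W)
    (hr : Relation.ReflTransGen (AuxRep W) F0 F) {x y : V} (hW : s(x, y) ∈ W)
    (hn : ∀ j, s(x, y) ∉ F j) (i : Fin k) :
    (SimpleGraph.fromEdgeSet (↑(F i) ∩ auxE0 W F0)).Reachable x y := by
  classical
  have hreach : (SimpleGraph.fromEdgeSet (↑(F i) : Set (Sym2 V))).Reachable x y := by
    by_contra hnr
    have h1 := aux_insert_acyclic (hF.2.2 i) hnr
    rw [← Finset.coe_insert] at h1
    have h2 := aux_pack_le (aux_update_pack hF i _ (F i) s(x, y) hW hn subset_rfl (by congr!) h1)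
    have h3 := aux_sum_update F i (insert s(x, y) (F i))
    rw [Finset.card_insert_of_notMem (hn i)] at h3
    have h4 : ∑ j, (Function.update F i (insert s(x, y) (F i)) j).card ≤ rkk k W := by
      convert h2
    omega
  obtain ⟨p, hp⟩ := hreach.exists_isPath
  refine ⟨p.transfer _ ?_⟩
  intro g hg
  have hgF := p.edges_subset_edgeSet hg
  rw [SimpleGraph.edgeSet_fromEdgeSet] at hgF ⊢
  refine ⟨⟨hgF.1, hF.1 i hgF.1, ?_⟩, hgF.2⟩
  have hsub : (↑((F i).erase g) : Set (Sym2 V)) ⊆ ↑(F i) :=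
    Finset.coe_subset.2 (Finset.erase_subset _ _)
  have hnr : ¬ (SimpleGraph.fromEdgeSet (↑((F i).erase g) : Set (Sym2 V))).Reachable x y := by
    intro h
    obtain ⟨q, hq⟩ := h.exists_isPath
    have hq1 : ∀ a ∈ q.edges, a ∈ (F i).erase g := by
      intro a ha
      have := q.edges_subset_edgeSet ha
      rw [SimpleGraph.edgeSet_fromEdgeSet] at this
      exact this.1
    have hq2 : ∀ a ∈ q.edges,
        a ∈ (SimpleGraph.fromEdgeSet (↑(F i) : Set (Sym2 V))).edgeSet := by
      intro a ha
      exact SimpleGraph.edgeSet_mono (SimpleGraph.fromEdgeSet_mono hsub)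
        (q.edges_subset_edgeSet ha)
    have := (hF.2.2 i).path_unique ⟨p, hp⟩ ⟨q.transfer _ hq2, hq.transfer hq2⟩
    have h3 := congrArg (fun r => r.1.edges) this
    simp only [SimpleGraph.Walk.edges_transfer] at h3
    rw [h3] at hg
    exact Finset.notMem_erase g _ (hq1 g hg)
  have hac := aux_insert_acyclic
    ((hF.2.2 i).anti (SimpleGraph.fromEdgeSet_mono hsub)) hnr
  rw [← Finset.coe_insert] at hac
  refine ⟨Function.update F i (insert s(x, y) ((F i).erase g)),
    hr.tail ⟨i, s(x, y), g, hW, hn, hgF.1, by congr!, by convert hac⟩, ?_⟩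
  intro j hj
  by_cases hji : j = i
  · subst hji
    rw [Function.update_self] at hj
    rcases Finset.mem_insert.1 hj with rfl | hj
    · exact hn j hgF.1
    · exact Finset.notMem_erase g _ hj
  · rw [Function.update_of_ne hji] at hj
    exact Finset.disjoint_left.1 (hF.2.1 hji) hj hgF.1

theorem aux_step2 {V : Type*} [Fintype V] {k : ℕ} {W : Set (Sym2 V)}
    {F0 F : Fin k → Finset (Sym2 V)}
    (hF0 : AuxPack k W F0) (hmax : ∑ i, (F0 i).card = rkk k W)
    (hr : Relation.ReflTransGen (AuxRep W) F0 F) :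
    (AuxPack k W F ∧ ∑ i, (F i).card = rkk k W) ∧ ∀ i x y,
      (SimpleGraph.fromEdgeSet (↑(F i) ∩ auxE0 W F0)).Reachable x y →
      (SimpleGraph.fromEdgeSet (↑(F0 i) ∩ auxE0 W F0)).Reachable x y := by
  classical
  induction hr with
  | refl => exact ⟨⟨hF0, hmax⟩, fun _ _ _ h => h⟩
  | tail hr hrep ih =>
    rename_i F F'
    obtain ⟨⟨hF, hm⟩, ih⟩ := ih
    have h1 := aux_rep_max hF hrep
    refine ⟨⟨h1.1, h1.2.trans hm⟩, ?_⟩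
    intro i x y hxy
    apply ih
    refine aux_reach_of_adj ?_ hxy
    intro a b hab
    rw [SimpleGraph.fromEdgeSet_adj] at hab
    obtain ⟨⟨hab1, hab2⟩, hne⟩ := hab
    by_cases hmem : s(a, b) ∈ F i
    · apply SimpleGraph.Adj.reachable
      rw [SimpleGraph.fromEdgeSet_adj]
      exact ⟨⟨hmem, hab2⟩, hne⟩
    · obtain ⟨j, f, g, hf, hfF, hg, rfl, -⟩ := hrep
      have hfe : s(a, b) = f := by
        by_cases hij : i = j
        · subst hij
          rw [Function.update_self] at hab1
          rcases Finset.mem_insert.1 hab1 with h | h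
          · exact h
          · exact absurd (Finset.mem_of_mem_erase h) hmem
        · rw [Function.update_of_ne hij] at hab1
          exact absurd hab1 hmem
      subst hfe
      exact aux_step1 hF hm hr hf hfF i

theorem aux_hard {V : Type*} [Fintype V] (k : ℕ) (hk : 1 ≤ k)
    (E : Finset (Sym2 V)) (x y : V) (heE : s(x, y) ∉ E)
    (h : rkk k (insert s(x, y) (↑E : Set (Sym2 V))) = rkk k (↑E : Set (Sym2 V))) :
    ∃ C : Set V, DeeplyConnected k ((SimpleGraph.fromEdgeSet (↑E : Set (Sym2 V))).induce C) ∧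
      x ∈ C ∧ y ∈ C := by
  classical
  obtain ⟨F, hF, hs⟩ := aux_pack_exists k (↑E : Set (Sym2 V))
  set W : Set (Sym2 V) := insert s(x, y) (↑E : Set (Sym2 V)) with hWdef
  have hFW : AuxPack k W F := ⟨fun i => (hF.1 i).trans (Set.subset_insert _ _), hF.2⟩
  have hmax : ∑ i, (F i).card = rkk k W := by rw [hs, h]
  have hn : ∀ j, s(x, y) ∉ F j := fun j hj => heE (hF.1 j hj)
  have hkey : ∀ i a b, s(a, b) ∈ auxE0 W F →
      (SimpleGraph.fromEdgeSet (↑(F i) ∩ auxE0 W F)).Reachable a b := by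
    rintro i a b ⟨hab, F', hr, hF'⟩
    obtain ⟨⟨h1, h2⟩, h3⟩ := aux_step2 hFW hmax hr
    exact h3 i a b (aux_step1 h1 h2 hr hab hF' i)
  let C := ((SimpleGraph.fromEdgeSet (auxE0 W F)).connectedComponentMk x).supp
  have hCi : ∀ i, C =
      ((SimpleGraph.fromEdgeSet (↑(F i) ∩ auxE0 W F)).connectedComponentMk x).supp := by
    intro i
    ext v
    simp only [C, SimpleGraph.ConnectedComponent.mem_supp_iff, SimpleGraph.ConnectedComponent.eq]
    constructor
    · intro hv
      refine aux_reach_of_adj ?_ hv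
      intro a b hab
      exact hkey i a b ((SimpleGraph.fromEdgeSet_adj _).1 hab).1
    · intro hv
      exact hv.mono (SimpleGraph.fromEdgeSet_mono Set.inter_subset_right)
  have hxy0 : s(x, y) ∈ auxE0 W F :=
    ⟨Set.mem_insert _ _, F, Relation.ReflTransGen.refl, hn⟩
  refine ⟨C, ⟨fun i => (((SimpleGraph.fromEdgeSet (↑(F i) : Set (Sym2 V))).induce C).edgeSet),
    ?_, ?_, ?_⟩, ?_, ?_⟩
  · intro i
    apply SimpleGraph.edgeSet_mono
    intro a b hab
    simp only [SimpleGraph.comap_adj, SimpleGraph.fromEdgeSet_adj] at hab ⊢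
    exact ⟨hF.1 i hab.1, hab.2⟩
  · intro i
    unfold IsSpanningTreeSet
    rw [SimpleGraph.fromEdgeSet_edgeSet]
    refine ⟨?_, (hF.2.2 i).induce C⟩
    have h1 := ((SimpleGraph.fromEdgeSet
      (↑(F i) ∩ auxE0 W F)).connectedComponentMk x).connected_toSimpleGraph
    have h2 : ((SimpleGraph.fromEdgeSet (↑(F i) ∩ auxE0 W F)).induce C).Connected := by
      rw [hCi i]
      exact h1
    refine h2.mono ?_
    intro a b hab
    simp only [SimpleGraph.comap_adj, SimpleGraph.fromEdgeSet_adj] at hab ⊢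
    exact ⟨hab.1.1, hab.2⟩
  · intro i j hij
    rw [Set.disjoint_left]
    intro f hf hf'
    induction f with
    | h a b =>
      simp only [SimpleGraph.mem_edgeSet, SimpleGraph.comap_adj,
        SimpleGraph.fromEdgeSet_adj] at hf hf'
      exact Finset.disjoint_left.1 (hF.2.1 hij) hf.1 hf'.1
  · simp [C]
  · simp only [C, SimpleGraph.ConnectedComponent.mem_supp_iff, SimpleGraph.ConnectedComponent.eq]
    exact ((hkey ⟨0, hk⟩ x y hxy0).mono
      (SimpleGraph.fromEdgeSet_mono Set.inter_subset_right)).symm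

theorem stmt6 {V : Type*} [Fintype V] (k : ℕ) (hk : 1 ≤ k)
    (E : Finset (Sym2 V)) (hE : ∀ e ∈ E, ¬ e.IsDiag)
    (e : Sym2 V) (he : ¬ e.IsDiag) (heE : e ∉ E) :
    rkk k (insert e (↑E : Set (Sym2 V))) = rkk k (↑E : Set (Sym2 V)) ↔
      ∃ C : Set V, DeepComponent k (SimpleGraph.fromEdgeSet (↑E : Set (Sym2 V))) C ∧
        ∀ v ∈ e, v ∈ C := by
  constructor
  · intro h
    induction e with
    | h x y =>
      obtain ⟨C, hC, hx, hy⟩ := aux_hard k hk E x y heE h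
      obtain ⟨D, hCD, hD⟩ := Finite.exists_le_maximal
        (p := fun C : Set V => DeeplyConnected k
          ((SimpleGraph.fromEdgeSet (↑E : Set (Sym2 V))).induce C)) hC
      refine ⟨D, ⟨hD.prop, fun C' hDC' hC' => ?_⟩, ?_⟩
      · exact Set.Subset.antisymm (hD.le_of_ge hC' hDC') hDC'
      · intro v hv
        rw [Sym2.mem_iff] at hv
        rcases hv with rfl | rfl
        · exact hCD hx
        · exact hCD hy
  · rintro ⟨C, hC, heC⟩
    exact le_antisymm (aux_easy k E hE e he heE C hC.1 heC)
      (aux_rkk_mono k (Set.subset_insert _ _))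
end

section
/- For all reals ε > 0 and c > 0 there exists δ = δ(ε, c) > 0 such that, with high probability, the uniform random graph G(n, ⌈cn⌉) contains no subgraph with at most δn vertices (and at least one vertex) whose density is at least 2 + ε. -/
open MeasureTheory Filter

/-- The non-loop edges of `K_n`. -/
noncomputable def allEdges (n : ℕ) : Finset (Sym2 (Fin n)) :=
  Finset.univ.filter fun e => ¬ e.IsDiag

lemma card_allEdges (n : ℕ) : (allEdges n).card = n.choose 2 := by
  have h := Sym2.card_subtype_not_diag (α := Fin n)
  rw [Fintype.card_fin, Fintype.card_subtype] at h
  rw [← h, allEdges]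

lemma graphEdgeSets_eq (n m : ℕ) :
    graphEdgeSets n m = (allEdges n).powersetCard m := by
  ext S
  simp only [graphEdgeSets, allEdges, Finset.mem_filter, Finset.mem_univ, true_and,
    Finset.mem_powersetCard, Finset.subset_iff]
  tauto

lemma card_graphEdgeSets (n m : ℕ) : (graphEdgeSets n m).card = (n.choose 2).choose m := by
  rw [graphEdgeSets_eq, Finset.card_powersetCard, card_allEdges]

open Classical in
lemma gnm_apply (n m : ℕ) (A : Set (Finset (Sym2 (Fin n)))) :
    gnm n m A = ((graphEdgeSets n m).card : ENNReal)⁻¹ *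
      (((graphEdgeSets n m).filter (fun S => S ∈ A)).card : ENNReal) := by
  rw [gnm, Measure.smul_apply, Measure.finsetSum_apply, smul_eq_mul]
  congr 1
  rw [Finset.card_filter]
  push_cast
  refine Finset.sum_congr rfl fun S _ => ?_
  rw [Measure.dirac_apply' _ (by trivial)]
  simp [Set.indicator_apply]

lemma descFactorial_ratio (N m k : ℕ) (h : m ≤ N) :
    m.descFactorial k * N ^ k ≤ m ^ k * N.descFactorial k := by
  induction k with
  | zero => simp
  | succ k ih =>
    rw [Nat.descFactorial_succ, Nat.descFactorial_succ, pow_succ, pow_succ]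
    have h1 : (m - k) * N ≤ m * (N - k) := by
      rw [Nat.sub_mul, Nat.mul_sub]
      have : k * m ≤ k * N := Nat.mul_le_mul_left _ h
      rw [Nat.mul_comm m k]
      omega
    calc (m - k) * m.descFactorial k * (N ^ k * N)
        = (m.descFactorial k * N ^ k) * ((m - k) * N) := by ring
      _ ≤ (m ^ k * N.descFactorial k) * (m * (N - k)) := Nat.mul_le_mul ih h1
      _ = _ := by ring

lemma choose_ratio (N m k : ℕ) (h : m ≤ N) :
    m.choose k * N ^ k ≤ m ^ k * N.choose k := by
  have := descFactorial_ratio N m k h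
  rw [Nat.descFactorial_eq_factorial_mul_choose, Nat.descFactorial_eq_factorial_mul_choose] at this
  refine Nat.le_of_mul_le_mul_left (c := k.factorial) ?_ (Nat.factorial_pos k)
  calc _ = k.factorial * m.choose k * N ^ k := by ring
    _ ≤ _ := this
    _ = _ := by ring

lemma count_supersets (n m k : ℕ) (hm : m ≤ n.choose 2) (F : Finset (Sym2 (Fin n)))
    (hF : F.card = k) :
    ((graphEdgeSets n m).filter (fun S => F ⊆ S)).card * (n.choose 2) ^ k ≤
      m ^ k * (graphEdgeSets n m).card := by
  classical
  rcases Finset.eq_empty_or_nonempty ((graphEdgeSets n m).filter (fun S => F ⊆ S)) with h | ⟨S₀, h₀⟩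
  · rw [h]; simp
  rw [graphEdgeSets_eq, Finset.mem_filter, Finset.mem_powersetCard] at h₀
  obtain ⟨⟨hS, hc⟩, hFS⟩ := h₀
  have hkm : k ≤ m := by rw [← hF, ← hc]; exact Finset.card_le_card hFS
  have hFE : F ⊆ allEdges n := hFS.trans hS
  have h1 : ((graphEdgeSets n m).filter (fun S => F ⊆ S)).card ≤
      (n.choose 2 - k).choose (m - k) := by
    have : (n.choose 2 - k).choose (m - k) = ((allEdges n \ F).powersetCard (m - k)).card := by
      rw [Finset.card_powersetCard, Finset.card_sdiff_of_subset hFE, card_allEdges, hF]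
    rw [this]
    refine Finset.card_le_card_of_injOn (fun S => S \ F) ?_ ?_
    · intro S hS
      simp only [Finset.coe_filter, Set.mem_ofPred_eq, graphEdgeSets_eq, Finset.mem_powersetCard] at hS
      simp only [Finset.mem_coe, Finset.mem_powersetCard]
      refine ⟨Finset.sdiff_subset_sdiff hS.1.1 le_rfl, ?_⟩
      rw [Finset.card_sdiff_of_subset hS.2, hS.1.2, hF]
    · intro S hS T hT hST
      simp only [Finset.coe_filter, Set.mem_ofPred_eq] at hS hT
      have hST' : S \ F = T \ F := hST
      rw [← Finset.sdiff_union_of_subset hS.2, hST', Finset.sdiff_union_of_subset hT.2]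
  have h2 := choose_ratio (n.choose 2) m k hm
  have h3 := Nat.choose_mul (n := n.choose 2) hkm
  rw [card_graphEdgeSets]
  refine Nat.le_of_mul_le_mul_left (c := (n.choose 2).choose k) ?_
    (Nat.choose_pos (hkm.trans hm))
  calc _ ≤ (n.choose 2).choose k * ((n.choose 2 - k).choose (m - k) * (n.choose 2) ^ k) := by gcongr
    _ = (n.choose 2).choose m * (m.choose k * (n.choose 2) ^ k) := by
        rw [← mul_assoc, ← h3]; ring
    _ ≤ (n.choose 2).choose m * (m ^ k * (n.choose 2).choose k) := by gcongr
    _ = _ := by ring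

lemma card_sym2_le {n : ℕ} (U : Finset (Fin n)) : U.sym2.card ≤ U.card ^ 2 := by
  rw [Finset.card_sym2, Nat.choose_two_right]
  refine Nat.div_le_of_le_mul ?_
  rw [Nat.add_sub_cancel]
  nlinarith [Nat.le_self_pow (n := 2) (by norm_num) U.card]

open Classical in
lemma bad_for_U (n m k : ℕ) (hm : m ≤ n.choose 2) (U : Finset (Fin n)) :
    ((graphEdgeSets n m).filter (fun S => k ≤ (S ∩ U.sym2).card)).card * (n.choose 2) ^ k ≤
      (U.card ^ 2).choose k * (m ^ k * (graphEdgeSets n m).card) := by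
  have h1 : (graphEdgeSets n m).filter (fun S => k ≤ (S ∩ U.sym2).card) ⊆
      (U.sym2.powersetCard k).biUnion
        (fun F => (graphEdgeSets n m).filter (fun S => F ⊆ S)) := by
    intro S hS
    rw [Finset.mem_filter] at hS
    obtain ⟨F, hF, hFk⟩ := Finset.exists_subset_card_eq hS.2
    rw [Finset.mem_biUnion]
    refine ⟨F, Finset.mem_powersetCard.2 ⟨hF.trans Finset.inter_subset_right, hFk⟩, ?_⟩
    exact Finset.mem_filter.2 ⟨hS.1, hF.trans Finset.inter_subset_left⟩
  calc _ ≤ (∑ F ∈ U.sym2.powersetCard k, ((graphEdgeSets n m).filter (fun S => F ⊆ S)).card)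
          * (n.choose 2) ^ k := by
        gcongr
        exact (Finset.card_le_card h1).trans Finset.card_biUnion_le
    _ = ∑ F ∈ U.sym2.powersetCard k, ((graphEdgeSets n m).filter (fun S => F ⊆ S)).card
          * (n.choose 2) ^ k := Finset.sum_mul _ _ _
    _ ≤ ∑ F ∈ U.sym2.powersetCard k, m ^ k * (graphEdgeSets n m).card := by
        refine Finset.sum_le_sum fun F hF => ?_
        exact count_supersets n m k hm F (Finset.mem_powersetCard.1 hF).2
    _ = (U.sym2.card).choose k * (m ^ k * (graphEdgeSets n m).card) := by
        rw [Finset.sum_const, Finset.card_powersetCard, smul_eq_mul]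
    _ ≤ _ := by
        gcongr
        exact card_sym2_le U

/-- The good event. -/
def goodSet (n : ℕ) (ε δ : ℝ) : Set (Finset (Sym2 (Fin n))) :=
  {S : Finset (Sym2 (Fin n)) | ∀ U : Set (Fin n), U.Nonempty →
          (U.ncard : ℝ) ≤ δ * n →
          (2 * (edgesIn (↑S) U).ncard : ℝ) / U.ncard < 2 + ε}

lemma edgesIn_ncard {n : ℕ} (S : Finset (Sym2 (Fin n))) (U : Finset (Fin n)) :
    (edgesIn (↑S : Set (Sym2 (Fin n))) (↑U : Set (Fin n))).ncard = (S ∩ U.sym2).card := by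
  rw [← Set.ncard_coe_finset]
  congr 1
  ext e
  simp only [edgesIn, Finset.coe_inter, Set.mem_inter_iff, Finset.mem_coe, Finset.mem_sym2_iff]
  rfl

open Classical in
lemma bad_count (n m : ℕ) (ε δ : ℝ) (hm : m ≤ n.choose 2)
    (hN : 0 < n.choose 2) :
    (((graphEdgeSets n m).filter (fun S => S ∈ (goodSet n ε δ)ᶜ)).card : ℝ) ≤
      (graphEdgeSets n m).card * ∑ u ∈ Finset.Icc 1 ⌊δ * n⌋₊,
        (n.choose u : ℝ) * (((u ^ 2).choose ⌈(1 + ε / 2) * u⌉₊ : ℝ) *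
          ((m : ℝ) / (n.choose 2 : ℕ)) ^ ⌈(1 + ε / 2) * u⌉₊) := by
  have h1 : (graphEdgeSets n m).filter (fun S => S ∈ (goodSet n ε δ)ᶜ) ⊆
      (Finset.Icc 1 ⌊δ * n⌋₊).biUnion fun u =>
        ((Finset.univ : Finset (Fin n)).powersetCard u).biUnion fun U =>
          (graphEdgeSets n m).filter (fun S => ⌈(1 + ε / 2) * u⌉₊ ≤ (S ∩ U.sym2).card) := by
    intro S hS
    rw [Finset.mem_filter] at hS
    obtain ⟨hS1, hS2⟩ := hS
    simp only [goodSet, Set.mem_compl_iff, Set.mem_ofPred_eq, not_forall, not_lt] at hS2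
    obtain ⟨U, hU, hUd, hUe⟩ := hS2
    obtain ⟨U, rfl⟩ : ∃ V : Finset (Fin n), U = ↑V := ⟨U.toFinset, by simp⟩
    rw [edgesIn_ncard, Set.ncard_coe_finset] at hUe
    rw [Set.ncard_coe_finset] at hUd
    have hpos : 0 < U.card := Finset.card_pos.2 (by simpa using hU)
    have hposR : (0 : ℝ) < U.card := by exact_mod_cast hpos
    simp only [Finset.mem_biUnion, Finset.mem_Icc, Finset.mem_powersetCard, Finset.mem_filter]
    refine ⟨U.card, ⟨hpos, Nat.le_floor hUd⟩, U, ⟨Finset.subset_univ _, rfl⟩, hS1, ?_⟩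
    rw [le_div_iff₀ hposR] at hUe
    exact Nat.ceil_le.2 (by linarith)
  have h2 : (((graphEdgeSets n m).filter (fun S => S ∈ (goodSet n ε δ)ᶜ)).card : ℝ) ≤
      ∑ u ∈ Finset.Icc 1 ⌊δ * n⌋₊, ∑ U ∈ (Finset.univ : Finset (Fin n)).powersetCard u,
        (((graphEdgeSets n m).filter
          (fun S => ⌈(1 + ε / 2) * u⌉₊ ≤ (S ∩ U.sym2).card)).card : ℝ) := by
    have := (Finset.card_le_card h1).trans (Finset.card_biUnion_le.trans
      (Finset.sum_le_sum fun u _ => Finset.card_biUnion_le))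
    exact_mod_cast this
  refine h2.trans ?_
  rw [Finset.mul_sum]
  refine Finset.sum_le_sum fun u _ => ?_
  have hNR : (0 : ℝ) < (n.choose 2 : ℕ) := by exact_mod_cast hN
  have h3 : ∀ U ∈ (Finset.univ : Finset (Fin n)).powersetCard u,
      (((graphEdgeSets n m).filter
          (fun S => ⌈(1 + ε / 2) * u⌉₊ ≤ (S ∩ U.sym2).card)).card : ℝ) ≤
      (graphEdgeSets n m).card * (((u ^ 2).choose ⌈(1 + ε / 2) * u⌉₊ : ℝ) *
          ((m : ℝ) / (n.choose 2 : ℕ)) ^ ⌈(1 + ε / 2) * u⌉₊) := by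
    intro U hU
    have h4 := bad_for_U n m ⌈(1 + ε / 2) * u⌉₊ hm U
    rw [(Finset.mem_powersetCard.1 hU).2] at h4
    have h5 : (((graphEdgeSets n m).filter
          (fun S => ⌈(1 + ε / 2) * u⌉₊ ≤ (S ∩ U.sym2).card)).card : ℝ) *
          ((n.choose 2 : ℕ) : ℝ) ^ ⌈(1 + ε / 2) * u⌉₊ ≤
        ((u ^ 2).choose ⌈(1 + ε / 2) * u⌉₊ : ℝ) *
          ((m : ℝ) ^ ⌈(1 + ε / 2) * u⌉₊ * (graphEdgeSets n m).card) := by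
      exact_mod_cast h4
    rw [← le_div_iff₀ (by positivity)] at h5
    refine h5.trans (le_of_eq ?_)
    rw [div_pow]
    ring
  refine (Finset.sum_le_sum h3).trans (le_of_eq ?_)
  rw [Finset.sum_const, Finset.card_powersetCard, Finset.card_univ, Fintype.card_fin, nsmul_eq_mul]
  ring

lemma choose_le_exp (a b : ℕ) (hb : 0 < b) :
    (a.choose b : ℝ) ≤ (Real.exp 1 * (a / b)) ^ b := by
  have hbR : (0 : ℝ) < b := by exact_mod_cast hb
  have h1 : (a.choose b : ℝ) ≤ (a : ℝ) ^ b / b.factorial := Nat.choose_le_pow_div b a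
  have h2 : (b : ℝ) ^ b / b.factorial ≤ Real.exp b := Real.pow_div_factorial_le_exp b hbR.le b
  calc (a.choose b : ℝ) ≤ (a : ℝ) ^ b / b.factorial := h1
    _ = ((a : ℝ) / b) ^ b * ((b : ℝ) ^ b / b.factorial) := by
        rw [div_pow]; field_simp
    _ ≤ ((a : ℝ) / b) ^ b * Real.exp b := by gcongr
    _ = _ := by
        rw [mul_pow, ← Real.exp_nat_mul, mul_one]; ring

lemma term_bound (n m u : ℕ) (ε c A : ℝ) (hε : 0 < ε) (hc : 0 < c)
    (hA : A = 4 * Real.exp 1 * (c + 1)) (hn : 2 ≤ n) (hu : 0 < u)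
    (hm : (m : ℝ) ≤ (c + 1) * n) (hAu : A * (u / n) ≤ 1) :
    (n.choose u : ℝ) * (((u ^ 2).choose ⌈(1 + ε / 2) * u⌉₊ : ℝ) *
          ((m : ℝ) / (n.choose 2 : ℕ)) ^ ⌈(1 + ε / 2) * u⌉₊) ≤
      (Real.exp 1 * A * (A * (u / n)) ^ (ε / 2)) ^ u := by
  have huR : (0 : ℝ) < u := by exact_mod_cast hu
  have hnR : (2 : ℝ) ≤ n := by exact_mod_cast hn
  have hn0 : (0 : ℝ) < n := by linarith
  have he : (0 : ℝ) < Real.exp 1 := Real.exp_pos 1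
  have hA0 : 0 < A := by rw [hA]; positivity
  have hr0 : 0 < A * (u / n) := by positivity
  set k := ⌈(1 + ε / 2) * u⌉₊ with hk
  have hk1 : (1 + ε / 2) * u ≤ k := Nat.le_ceil _
  have hku : (u : ℝ) ≤ k := by nlinarith
  have hk0 : (0 : ℝ) < k := by linarith
  have hmN : (m : ℝ) / (n.choose 2 : ℕ) ≤ 4 * (c + 1) / n := by
    rw [Nat.cast_choose_two]
    rw [div_le_div_iff₀ (by nlinarith) hn0]
    calc (m : ℝ) * n ≤ ((c + 1) * n) * n := by gcongr
      _ ≤ 4 * (c + 1) * (n * (n - 1) / 2) := by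
        have : 0 ≤ (c + 1) * n * (n - 2) := by
          have : (0 : ℝ) ≤ n - 2 := by linarith
          positivity
        nlinarith
  have h1 : ((u ^ 2).choose k : ℝ) ≤ (Real.exp 1 * u) ^ k := by
    refine (choose_le_exp (u ^ 2) k (by exact_mod_cast hk0)).trans ?_
    gcongr
    rw [div_le_iff₀ hk0]
    push_cast
    nlinarith
  have h2 : ((u ^ 2).choose k : ℝ) * ((m : ℝ) / (n.choose 2 : ℕ)) ^ k ≤ (A * (u / n)) ^ k := by
    calc _ ≤ (Real.exp 1 * u) ^ k * (4 * (c + 1) / n) ^ k := by gcongr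
      _ = _ := by rw [← mul_pow, hA]; congr 1; ring
  have h3 : (A * (u / n)) ^ k ≤ ((A * (u / n)) * (A * (u / n)) ^ (ε / 2)) ^ u := by
    have : (A * (u / n)) * (A * (u / n)) ^ (ε / 2) = (A * (u / n)) ^ (1 + ε / 2) := by
      rw [Real.rpow_add hr0, Real.rpow_one]
    rw [this, ← Real.rpow_natCast, ← Real.rpow_natCast, ← Real.rpow_mul hr0.le]
    exact Real.rpow_le_rpow_of_exponent_ge hr0 hAu hk1
  calc _ ≤ (Real.exp 1 * (n / u)) ^ u * ((A * (u / n)) * (A * (u / n)) ^ (ε / 2)) ^ u := by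
        gcongr
        · exact choose_le_exp n u hu
        · exact h2.trans h3
    _ = _ := by
        rw [← mul_pow]
        congr 1
        field_simp

lemma sum_tendsto (ε A δ : ℝ) (hε : 0 < ε) (hA : 0 < A) (hδ : 0 < δ)
    (hAδ : Real.exp 1 * A * (A * δ) ^ (ε / 2) ≤ 1 / 2) :
    Tendsto (fun n : ℕ => ∑ u ∈ Finset.Icc 1 ⌊δ * n⌋₊,
      (Real.exp 1 * A * (A * ((u : ℝ) / n)) ^ (ε / 2)) ^ u) atTop (nhds 0) := by
  classical
  have key : Tendsto (fun n : ℕ => ∑' u : ℕ, if u ∈ Finset.Icc 1 ⌊δ * n⌋₊ then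
      (Real.exp 1 * A * (A * ((u : ℝ) / n)) ^ (ε / 2)) ^ u else 0) atTop
      (nhds (∑' _ : ℕ, (0 : ℝ))) := by
    refine tendsto_tsum_of_dominated_convergence (bound := fun u : ℕ => (1 / 2 : ℝ) ^ u)
      summable_geometric_two ?_ ?_
    · intro u
      rcases Nat.eq_zero_or_pos u with rfl | hu
      · simp
      have h0 : Tendsto (fun n : ℕ =>
          (Real.exp 1 * A * (A * ((u : ℝ) / n)) ^ (ε / 2)) ^ u) atTop (nhds 0) := by
        have h1 : Tendsto (fun n : ℕ => A * ((u : ℝ) / n)) atTop (nhds 0) := by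
          simpa using (tendsto_const_div_atTop_nhds_zero_nat (u : ℝ)).const_mul A
        have h2 := h1.rpow_const (p := ε / 2) (Or.inr (by positivity))
        rw [Real.zero_rpow (by positivity)] at h2
        have h3 := (h2.const_mul (Real.exp 1 * A)).pow u
        simpa [hu.ne'] using h3
      refine squeeze_zero (fun n => ?_) (fun n => ?_) h0
      · split_ifs <;> positivity
      · split_ifs
        · exact le_rfl
        · positivity
    · refine Eventually.of_forall fun n u => ?_
      split_ifs with h
      · rw [Finset.mem_Icc] at h
        rw [Real.norm_of_nonneg (by positivity)]
        have hu : (u : ℝ) ≤ δ * n := (Nat.le_floor_iff (by positivity)).1 h.2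
        have h1 : (u : ℝ) / n ≤ δ := div_le_of_le_mul₀ (by positivity) hδ.le hu
        refine pow_le_pow_left₀ (by positivity) (le_trans ?_ hAδ) u
        gcongr
      · simp
  rw [tsum_zero] at key
  refine key.congr fun n => ?_
  rw [tsum_eq_sum (s := Finset.Icc 1 ⌊δ * n⌋₊) (fun u hu => if_neg hu)]
  exact Finset.sum_congr rfl fun u hu => if_pos hu

theorem stmt8 (ε c : ℝ) (hε : 0 < ε) (hc : 0 < c) :
    ∃ δ : ℝ, 0 < δ ∧
      Tendsto (fun n : ℕ => gnm n ⌈c * n⌉₊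
        {S : Finset (Sym2 (Fin n)) | ∀ U : Set (Fin n), U.Nonempty →
          (U.ncard : ℝ) ≤ δ * n →
          (2 * (edgesIn (↑S) U).ncard : ℝ) / U.ncard < 2 + ε})
      atTop (nhds 1) := by
  classical
  set A : ℝ := 4 * Real.exp 1 * (c + 1) with hA
  have he : (1 : ℝ) ≤ Real.exp 1 := Real.one_le_exp (by norm_num)
  have hA1 : 1 ≤ A := by rw [hA]; nlinarith
  have hA0 : 0 < A := by linarith
  set δ : ℝ := (1 / (2 * (Real.exp 1 * A))) ^ (2 / ε) / A with hδ
  have hδ0 : 0 < δ := by positivity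
  have hAδ : A * δ = (1 / (2 * (Real.exp 1 * A))) ^ (2 / ε) := by
    rw [hδ]; field_simp
  have hAδ1 : A * δ ≤ 1 := by
    rw [hAδ]
    refine Real.rpow_le_one (by positivity) ?_ (by positivity)
    rw [div_le_one (by positivity)]
    nlinarith
  have hAδ2 : Real.exp 1 * A * (A * δ) ^ (ε / 2) ≤ 1 / 2 := by
    rw [hAδ, ← Real.rpow_mul (by positivity)]
    have : 2 / ε * (ε / 2) = 1 := by field_simp
    rw [this, Real.rpow_one]
    apply le_of_eq
    field_simp
  refine ⟨δ, hδ0, ?_⟩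
  change Tendsto (fun n : ℕ => gnm n ⌈c * n⌉₊ (goodSet n ε δ)) atTop (nhds 1)
  have hsum := sum_tendsto ε A δ hε hA0 hδ0 hAδ2
  have hsumE := ENNReal.tendsto_ofReal hsum
  rw [ENNReal.ofReal_zero] at hsumE
  have hlow : Tendsto (fun n : ℕ => 1 - ENNReal.ofReal (∑ u ∈ Finset.Icc 1 ⌊δ * n⌋₊,
      (Real.exp 1 * A * (A * ((u : ℝ) / n)) ^ (ε / 2)) ^ u)) atTop (nhds 1) := by
    have := ENNReal.Tendsto.sub (tendsto_const_nhds (x := (1 : ENNReal)) (f := atTop (α := ℕ)))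
      hsumE (Or.inl ENNReal.one_ne_top)
    simpa using this
  obtain ⟨n₀, hn₀⟩ := exists_nat_ge (2 * (c + 1) + 1)
  have hev : ∀ᶠ n : ℕ in atTop, 2 ≤ n ∧ ⌈c * n⌉₊ ≤ n.choose 2 ∧
      ((⌈c * n⌉₊ : ℕ) : ℝ) ≤ (c + 1) * n := by
    filter_upwards [eventually_ge_atTop (max 2 n₀)] with n hn
    have hn2 : 2 ≤ n := (le_max_left _ _).trans hn
    have hn2R : (2 : ℝ) ≤ n := by exact_mod_cast hn2
    have hnn : (n₀ : ℝ) ≤ n := by exact_mod_cast (le_max_right _ _).trans hn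
    have hceil : ((⌈c * n⌉₊ : ℕ) : ℝ) ≤ (c + 1) * n := by
      have := (Nat.ceil_lt_add_one (show 0 ≤ c * (n : ℝ) by positivity)).le
      linarith
    refine ⟨hn2, ?_, hceil⟩
    have : ((⌈c * n⌉₊ : ℕ) : ℝ) ≤ ((n.choose 2 : ℕ) : ℝ) := by
      rw [Nat.cast_choose_two]
      nlinarith
    exact_mod_cast this
  refine tendsto_of_tendsto_of_tendsto_of_le_of_le' hlow tendsto_const_nhds ?_ ?_
  · filter_upwards [hev] with n ⟨hn2, hmN, hm⟩
    set m := ⌈c * n⌉₊ with hmdef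
    have hN : 0 < n.choose 2 := Nat.choose_pos hn2
    have hT : 0 < (graphEdgeSets n m).card := by
      rw [card_graphEdgeSets]; exact Nat.choose_pos hmN
    have hT0 : ((graphEdgeSets n m).card : ENNReal) ≠ 0 := by exact_mod_cast hT.ne'
    have hTt : ((graphEdgeSets n m).card : ENNReal) ≠ ⊤ := ENNReal.natCast_ne_top _
    have hsplit : gnm n m (goodSet n ε δ) + gnm n m (goodSet n ε δ)ᶜ = 1 := by
      rw [gnm_apply, gnm_apply, ← mul_add]
      have : ((graphEdgeSets n m).filter (fun S => S ∈ goodSet n ε δ)).card +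
          ((graphEdgeSets n m).filter (fun S => S ∈ (goodSet n ε δ)ᶜ)).card =
          (graphEdgeSets n m).card :=
        Finset.card_filter_add_card_filter_not (fun S => S ∈ goodSet n ε δ)
      rw [← Nat.cast_add]
      convert ENNReal.inv_mul_cancel hT0 hTt using 3
      convert this
    have hbad : gnm n m (goodSet n ε δ)ᶜ ≤ ENNReal.ofReal (∑ u ∈ Finset.Icc 1 ⌊δ * n⌋₊,
      (Real.exp 1 * A * (A * ((u : ℝ) / n)) ^ (ε / 2)) ^ u) := by
      have hb := bad_count n m ε δ hmN hN
      have hn0 : (0 : ℝ) < n := by exact_mod_cast (by omega : 0 < n)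
      have hs : ∑ u ∈ Finset.Icc 1 ⌊δ * n⌋₊,
        (n.choose u : ℝ) * (((u ^ 2).choose ⌈(1 + ε / 2) * u⌉₊ : ℝ) *
          ((m : ℝ) / (n.choose 2 : ℕ)) ^ ⌈(1 + ε / 2) * u⌉₊) ≤ ∑ u ∈ Finset.Icc 1 ⌊δ * n⌋₊,
      (Real.exp 1 * A * (A * ((u : ℝ) / n)) ^ (ε / 2)) ^ u := by
        refine Finset.sum_le_sum fun u hu => ?_
        rw [Finset.mem_Icc] at hu
        refine term_bound n m u ε c A hε hc hA hn2 hu.1 hm ?_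
        have hu' : (u : ℝ) ≤ δ * n := (Nat.le_floor_iff (by positivity)).1 hu.2
        have h1 : (u : ℝ) / n ≤ δ := div_le_of_le_mul₀ (by positivity) hδ0.le hu'
        exact (mul_le_mul_of_nonneg_left h1 hA0.le).trans hAδ1
      have hb2 := hb.trans (mul_le_mul_of_nonneg_left hs (Nat.cast_nonneg _))
      rw [gnm_apply, mul_comm, ← div_eq_mul_inv]
      refine ENNReal.div_le_of_le_mul ?_
      rw [← ENNReal.ofReal_natCast, ← ENNReal.ofReal_natCast,
        ← ENNReal.ofReal_mul' (Nat.cast_nonneg _)]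
      refine ENNReal.ofReal_le_ofReal ?_
      rw [mul_comm]
      refine le_trans (le_of_eq ?_) hb2
      congr!
    rw [tsub_le_iff_right, ← hsplit]
    gcongr
  · refine Eventually.of_forall fun n => ?_
    rw [gnm_apply]
    calc _ ≤ ((graphEdgeSets n ⌈c * n⌉₊).card : ENNReal)⁻¹ *
          ((graphEdgeSets n ⌈c * n⌉₊).card : ENNReal) := by
          gcongr
          exact Finset.filter_subset _ _
      _ ≤ 1 := ENNReal.inv_mul_le_one _
end
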